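/- For every word w on an alphabet S and every function f : S → T, the reduction of the image under f of the reduction of w equals the reduction of the image under f of w; that is, r(f(r(w))) = r(f(w)). -/

import Mathlib

/-- One-step reduction of words: either an adjacent equal pair `aa` is replaced
by `a`, or (for a word of length at least two whose first and last letters are
equal) the last letter is deleted. -/
def Step {S : Type*} (w v : List S) : Prop :=
  (∃ (u₁ : List S) (a : S) (u₂ : List S), w = u₁ ++ [a, a] ++ u₂ ∧ v = u₁ ++ [a] ++ u₂) ∨
  (2 ≤ w.length ∧ w.head? = w.getLast? ∧ v = w.dropLast)

/-- A word is reduced if it has no two equal adjacent letters and either has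
length one or has different first and last letters. -/
def Reduced {S : Type*} (w : List S) : Prop :=
  w.Chain' (· ≠ ·) ∧ (w.length = 1 ∨ w.head? ≠ w.getLast?)

/-- `IsReduction w u` : the reduced word `u` is obtainable from `w` by a finite
(possibly empty) sequence of one-step reductions, i.e. `u = r(w)`. -/
def IsReduction {S : Type*} (w u : List S) : Prop :=
  Relation.ReflTransGen Step w u ∧ Reduced u

open Classical in
/-- The restriction `w|A` of a word to a sub-alphabet `A`: delete all letters not in `A`. -/
noncomputable def restrictWord {S : Type*} (w : List S) (A : Set S) : List S :=
  w.filter fun a => decide (a ∈ A)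

/-- A word is crossing if it contains the pattern `… a … b … a … b …` with `a ≠ b`. -/
def Crossing {S : Type*} (w : List S) : Prop :=
  ∃ (i j k l : ℕ) (hij : i < j) (hjk : j < k) (hkl : k < l) (hl : l < w.length),
    w[i]'(by omega) = w[k]'(by omega) ∧ w[j]'(by omega) = w[l]'hl ∧
    w[i]'(by omega) ≠ w[j]'(by omega)

open Classical in
noncomputable def dd {S : Type*} : List S → List S
  | [] => []
  | [a] => [a]
  | a :: b :: l => if a = b then dd (b :: l) else a :: dd (b :: l)

theorem dd_head {S : Type*} (w : List S) : (dd w).head? = w.head? := by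
  fun_induction dd w <;> simp_all

theorem dd_ne {S : Type*} (w : List S) : dd w = [] ↔ w = [] := by
  rw [← List.head?_eq_none_iff, dd_head, List.head?_eq_none_iff]

theorem dd_pair {S : Type*} (u₁ : List S) (a : S) (u₂ : List S) :
    dd (u₁ ++ a :: a :: u₂) = dd (u₁ ++ a :: u₂) := by
  induction u₁ with
  | nil => simp [dd]
  | cons b t ih =>
    cases t with
    | nil => simp [dd]
    | cons c t =>
      simp only [List.cons_append, dd] at ih ⊢
      rw [ih]

theorem dd_last {S : Type*} (w : List S) : (dd w).getLast? = w.getLast? := by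
  fun_induction dd w with
  | case1 => rfl
  | case2 => rfl
  | case3 b l ih => simp_all
  | case4 a b l h ih =>
    rw [List.getLast?_cons, ih]; simp [List.getLast?_cons]

open Classical in
theorem dd_concat {S : Type*} (v : List S) (a : S) :
    dd (v ++ [a]) = if v.getLast? = some a then dd v else dd v ++ [a] := by
  fun_induction dd v with
  | case1 => simp [dd]
  | case2 b => by_cases h : b = a <;> simp [dd, h]
  | case3 b l ih => simp_all [dd]
  | case4 c b l h ih =>
    simp only [List.cons_append, dd, if_neg h] at ih ⊢
    rw [ih, List.getLast?_cons_cons]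
    split_ifs <;> rfl

open Classical in
noncomputable def nn {S : Type*} (d : List S) : List S :=
  if 2 ≤ d.length ∧ d.head? = d.getLast? then d.dropLast else d

theorem nn_step {S : Type*} {w v : List S} (h : Step w v) : nn (dd w) = nn (dd v) := by
  rcases h with ⟨u₁, a, u₂, rfl, rfl⟩ | ⟨h2, hh, rfl⟩
  · have := dd_pair u₁ a u₂
    simp only [List.append_assoc, List.cons_append, List.nil_append]
    rw [this]
  · rcases List.eq_nil_or_concat w with rfl | ⟨v, a, rfl⟩
    · simp at h2
    · simp only [List.concat_eq_append] at *
      have hv : v ≠ [] := by rintro rfl; simp at h2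
      have hva : v.head? = some a := by
        cases v with
        | nil => exact absurd rfl hv
        | cons b t =>
          rw [List.getLast?_concat] at hh
          simpa using hh
      rw [List.dropLast_concat, dd_concat]
      split_ifs with hl
      · rfl
      · have h1 : nn (dd v) = dd v := by
          unfold nn
          rw [if_neg]
          rw [dd_head, dd_last, hva]
          exact fun h => hl h.2.symm
        rw [h1]
        unfold nn
        have hd : dd v ≠ [] := by rwa [Ne, dd_ne]
        have := List.length_pos_of_ne_nil hd
        rw [if_pos, List.dropLast_concat]
        refine ⟨by simp; omega, ?_⟩
        rw [List.head?_append, dd_head, hva]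
        simp

theorem dd_chain {S : Type*} (w : List S) (h : w.IsChain (· ≠ ·)) : dd w = w := by
  fun_induction dd w <;> simp_all

theorem nn_reduced {S : Type*} {w : List S} (h : Reduced w) : nn (dd w) = w := by
  rw [dd_chain w h.1]
  unfold nn
  rw [if_neg]
  rintro ⟨h1, h2⟩
  rcases h.2 with h3 | h3
  · omega
  · exact h3 h2

theorem nn_steps {S : Type*} {w v : List S} (h : Relation.ReflTransGen Step w v) :
    nn (dd w) = nn (dd v) := by
  induction h with
  | refl => rfl
  | tail _ h ih => rw [ih, nn_step h]

theorem step_map {S T : Type*} (f : S → T) {w v : List S} (h : Step w v) :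
    Step (w.map f) (v.map f) := by
  rcases h with ⟨u₁, a, u₂, rfl, rfl⟩ | ⟨h2, hh, rfl⟩
  · exact Or.inl ⟨u₁.map f, f a, u₂.map f, by simp, by simp⟩
  · exact Or.inr ⟨by simpa using h2, by simp [hh], by simp [List.map_dropLast]⟩

/-- Lemma 1.7 (reduce–function–reduce): for a word `w` on `S` and `f : S → T`,
`r(f(r(w))) = r(f(w))`. Stated via the reduction relation: if `u = r(w)`,
`x = r(f(u))` and `y = r(f(w))`, then `x = y`. -/
theorem reduce_map_reduce {S T : Type*} (f : S → T) (w : List S) (hw : w ≠ [])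
    (u : List S) (x y : List T)
    (hu : IsReduction w u)
    (hx : IsReduction (u.map f) x)
    (hy : IsReduction (w.map f) y) :
    x = y := by
  have h := nn_steps (Relation.ReflTransGen.lift (List.map f) (fun _ _ => step_map f) _ _ hu.1)
  rw [← nn_reduced hx.2, ← nn_reduced hy.2, ← nn_steps hx.1, ← nn_steps hy.1, h]
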